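/- arXiv:1206.4179 — 2 statements merged into one kernel-verified Lean document; each statement's English description precedes it below -/
import Mathlib

section
/- Let A be a commutative ring and F : Mod_A → Mod_A an A-linear functor which preserves filtered colimits. If F is finitely generated, then the set V(F) = { p ∈ Spec A : F(N) = 0 for every A-module N admitting an A_p-module structure } is open in the Zariski topology on Spec A. -/
open CategoryTheory CategoryTheory.Limits

universe u

variable {A : Type u} [CommRing A]

/-- A functor `F : Mod_A ⥤ Mod_A` is *finitely generated* if there are an `A`-module `I`
and an element `η ∈ F(I)` such that for every `A`-module `M` the map
`Hom_A(I, M) → F(M)`, `f ↦ F(f)(η)`, is surjective. -/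
def CategoryTheory.Functor.IsFinitelyGenerated (F : ModuleCat.{u} A ⥤ ModuleCat.{u} A) :
    Prop :=
  ∃ (I : ModuleCat.{u} A) (η : F.obj I),
    ∀ (M : ModuleCat.{u} A) (x : F.obj M), ∃ f : I ⟶ M, F.map f η = x


/-- The index category: objects are elements of a submonoid `S`, morphisms `s ⟶ t` are
elements `c ∈ S` with `c * s = t`. -/
structure LocIdx (S : Submonoid A) : Type u where
  val : S

instance (S : Submonoid A) : SmallCategory (LocIdx S) where
  Hom s t := {c : S // c * s.val = t.val}
  id s := ⟨1, one_mul _⟩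
  comp f g := ⟨g.1 * f.1, by rw [mul_assoc, f.2, g.2]⟩
  id_comp f := Subtype.ext (mul_one _)
  comp_id f := Subtype.ext (one_mul _)
  assoc f g h := Subtype.ext (mul_assoc _ _ _).symm

instance (S : Submonoid A) : IsFiltered (LocIdx S) where
  cocone_objs s t := ⟨⟨s.val * t.val⟩, ⟨t.val, mul_comm _ _⟩, ⟨s.val, rfl⟩, trivial⟩
  cocone_maps s t f g := ⟨⟨s.val * t.val⟩, ⟨s.val, rfl⟩, Subtype.ext (by
    change s.val * f.1 = s.val * g.1
    rw [mul_comm, f.2, mul_comm, g.2])⟩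
  nonempty := ⟨⟨1⟩⟩

/-- The diagram of copies of `I` with transition maps the multiplications. -/
def locDiag (S : Submonoid A) (I : ModuleCat.{u} A) : LocIdx S ⥤ ModuleCat.{u} A where
  obj _ := I
  map f := (f.1 : A) • 𝟙 I
  map_id s := by
    change ((1 : S) : A) • 𝟙 I = 𝟙 I
    simp
  map_comp f g := by
    change ((g.1 * f.1 : S) : A) • 𝟙 I = ((f.1 : A) • 𝟙 I) ≫ ((g.1 : A) • 𝟙 I)
    simp [smul_smul, mul_comm]

lemma locDiag_map_apply (S : Submonoid A) (I : ModuleCat.{u} A) {s t : LocIdx S} (f : s ⟶ t)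
    (x : I) : (locDiag S I).map f x = (f.1 : A) • x := rfl

lemma loc_bij (S : Submonoid A) (I : ModuleCat.{u} A) (a : A) (ha : a ∈ S) :
    Function.Bijective (fun n : (colimit (locDiag S I) : ModuleCat.{u} A) => a • n) := by
  constructor
  · have key : ∀ n : (colimit (locDiag S I) : ModuleCat.{u} A), a • n = 0 → n = 0 := by
      intro n hn
      obtain ⟨j, y, rfl⟩ := Concrete.colimit_exists_rep (locDiag S I) n
      have h2 : colimit.ι (locDiag S I) j (a • y) = colimit.ι (locDiag S I) j (0 : I) := by
        rw [map_smul, hn]; exact (map_zero (colimit.ι (locDiag S I) j).hom).symm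
      obtain ⟨k, f, g, h⟩ := Concrete.colimit_exists_of_rep_eq (locDiag S I) _ _ h2
      have h3 : (f.1 : A) • (a • (show I from y)) = 0 := by
        have : (f.1 : A) • (a • (show I from y)) = (g.1 : A) • (0 : I) := h
        rwa [smul_zero] at this
      have h4 : colimit.ι (locDiag S I) j y = colimit.ι (locDiag S I) j (0 : I) := by
        apply Concrete.colimit_rep_eq_of_exists
        refine ⟨⟨f.1 * ⟨a, ha⟩ * j.val⟩, ⟨f.1 * ⟨a, ha⟩, rfl⟩, ⟨f.1 * ⟨a, ha⟩, rfl⟩, ?_⟩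
        change ((f.1 : A) * a) • (show I from y) = ((f.1 : A) * a) • (0 : I)
        rw [smul_zero, mul_smul, h3]
      rw [h4]; exact map_zero (colimit.ι (locDiag S I) j).hom
    intro m n hmn
    rw [← sub_eq_zero]
    apply key
    rw [smul_sub, sub_eq_zero]
    exact hmn
  · intro n
    obtain ⟨j, y, rfl⟩ := Concrete.colimit_exists_rep (locDiag S I) n
    let k : LocIdx S := ⟨⟨a, ha⟩ * j.val⟩
    refine ⟨colimit.ι (locDiag S I) k (show I from y), ?_⟩
    refine ((colimit.ι (locDiag S I) k).hom.map_smul a (show I from y)).symm.trans ?_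
    symm
    apply Concrete.colimit_rep_eq_of_exists
    refine ⟨k, ⟨⟨a, ha⟩, rfl⟩, 𝟙 k, ?_⟩
    rw [CategoryTheory.Functor.map_id]
    rfl

/-- If `F : Mod_A → Mod_A` is an `A`-linear functor preserving filtered colimits which is
finitely generated, then the set
`V(F) = { p ∈ Spec A : F(N) = 0 for every A-module N admitting an A_p-module structure }`
is open in the Zariski topology on `Spec A`.  (An `A`-module `N` admits an `A_p`-module
structure exactly when every element of `A` outside `p` acts invertibly on `N`.) -/
theorem stmt14 (A : Type u) [CommRing A] (F : ModuleCat.{u} A ⥤ ModuleCat.{u} A)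
    [F.Additive] [F.Linear A] [PreservesFilteredColimits F]
    (hfg : F.IsFinitelyGenerated) :
    IsOpen {p : PrimeSpectrum A | ∀ N : ModuleCat.{u} A,
      (∀ a ∉ p.asIdeal, Function.Bijective (fun n : N => a • n)) →
      ∀ x : F.obj N, x = 0} := by
  obtain ⟨I, η, hη⟩ := hfg
  rw [isOpen_iff_forall_mem_open]
  intro p hp
  let S := p.asIdeal.primeCompl
  have hz := hp (colimit (locDiag S I)) (fun a ha => loc_bij S I a ha)
  let j : LocIdx S := ⟨1⟩
  obtain ⟨k, f, g, h⟩ := Concrete.isColimit_exists_of_rep_eq (locDiag S I ⋙ F)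
    (isColimitOfPreserves F (colimit.isColimit (locDiag S I))) (i := j) (j := j) η (0 : F.obj I)
    ((hz _).trans (hz _).symm)
  have hs : (f.1 : A) • η = 0 := by
    have e1 : F.map ((f.1 : A) • 𝟙 I) η = F.map ((g.1 : A) • 𝟙 I) 0 := h
    rw [map_zero, F.map_smul, F.map_id] at e1
    exact e1
  refine ⟨PrimeSpectrum.basicOpen (f.1 : A), ?_, (PrimeSpectrum.basicOpen _).isOpen, f.1.2⟩
  intro q hq N hN x
  have hb := hN (f.1 : A) hq
  obtain ⟨φ, rfl⟩ := hη N x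
  have h0 : (f.1 : A) • F.map φ η = 0 := by
    rw [← map_smul, hs, map_zero]
  let u : N ⟶ N := (f.1 : A) • 𝟙 N
  have : IsIso u := by
    rw [ConcreteCategory.isIso_iff_bijective]
    exact hb
  have h1 : F.map u (F.map φ η) = 0 := by
    rw [F.map_smul, F.map_id]
    exact h0
  have h2 := ((ConcreteCategory.isIso_iff_bijective (F.map u)).1 inferInstance).1
  apply h2
  rw [h1, map_zero]
end

section
/- Let A be a commutative ring and F : Mod_A → Mod_A an A-linear functor which preserves filtered colimits. If F is finitely generated, then there exists a generator (I, η) of F in which I is a finitely presented A-module. In particular, if A is noetherian, then G(M) is finitely generated for every finitely generated module M, and the same holds after base change to any noetherian A-algebra. -/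
open CategoryTheory CategoryTheory.Limits

universe u

variable {A : Type u} [CommRing A]

theorem aux_rep {A : Type u} [CommRing A] (F : ModuleCat.{u} A ⥤ ModuleCat.{u} A)
    [PreservesFilteredColimits F] {J : Type u} [SmallCategory J] [IsFiltered J]
    (D : J ⥤ ModuleCat.{u} A) (c : Cocone D)
    (hsurj : ∀ x : c.pt, ∃ i, ∃ y : D.obj i, x = c.ι.app i y)
    (hinj : ∀ i, ∀ x y : D.obj i, c.ι.app i x = c.ι.app i y →
      ∃ (k : J) (f : i ⟶ k), D.map f x = D.map f y)
    (η : F.obj c.pt) : ∃ (j : J) (y : F.obj (D.obj j)), F.map (c.ι.app j) y = η := by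
  have : ReflectsColimitsOfShape J (forget (ModuleCat.{u} A)) :=
    reflectsColimitsOfShape_of_reflectsIsomorphisms
  have h1 : IsColimit ((forget (ModuleCat.{u} A)).mapCocone c) :=
    Types.FilteredColimit.isColimitOf' _ _ hsurj hinj
  have h2 : IsColimit c := isColimitOfReflects (forget (ModuleCat.{u} A)) h1
  have : PreservesColimitsOfShape J F :=
    PreservesFilteredColimitsOfSize.preserves_filtered_colimits J
  have h3 : IsColimit (F.mapCocone c) := isColimitOfPreserves F h2
  exact Concrete.isColimit_exists_rep _ h3 η

theorem aux_step1 {A : Type u} [CommRing A] (F : ModuleCat.{u} A ⥤ ModuleCat.{u} A)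
    [PreservesFilteredColimits F] (I : ModuleCat.{u} A) (η : F.obj I) :
    ∃ (N : ModuleCat.{u} A) (g : N ⟶ I) (y : F.obj N), Module.Finite A N ∧ F.map g y = η := by
  let J := {N : Submodule A I // N.FG}
  have : Nonempty J := ⟨⟨⊥, Submodule.fg_bot⟩⟩
  have : IsDirectedOrder J := ⟨fun a b =>
    ⟨⟨a.1 ⊔ b.1, a.2.sup b.2⟩, (le_sup_left : a.1 ≤ _), (le_sup_right : b.1 ≤ _)⟩⟩
  let D : J ⥤ ModuleCat.{u} A :=
    { obj := fun N => ModuleCat.of A N.1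
      map := fun {N N'} h => ModuleCat.ofHom (Submodule.inclusion (leOfHom h : N.1 ≤ N'.1))
      map_id := fun N => rfl
      map_comp := fun f g => rfl }
  let c : Cocone D :=
    { pt := I
      ι := { app := fun N => ModuleCat.ofHom N.1.subtype
             naturality := fun N N' h => rfl } }
  obtain ⟨j, y, hy⟩ := aux_rep F D c
    (fun x => ⟨⟨Submodule.span A {x}, Submodule.fg_span_singleton x⟩,
      ⟨x, Submodule.mem_span_singleton_self x⟩, rfl⟩)
    (fun i x y h => ⟨i, 𝟙 i, by
      have : x = y := Subtype.ext h
      rw [this]⟩) η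
  exact ⟨D.obj j, c.ι.app j, y, Module.Finite.iff_fg.mpr j.2, hy⟩

theorem aux_step2 {A : Type u} [CommRing A] (F : ModuleCat.{u} A ⥤ ModuleCat.{u} A)
    [PreservesFilteredColimits F] (I : ModuleCat.{u} A) [Module.Finite A I] (η : F.obj I) :
    ∃ (N : ModuleCat.{u} A) (g : N ⟶ I) (y : F.obj N),
      Module.FinitePresentation A N ∧ F.map g y = η := by
  obtain ⟨n, p, hp⟩ := Module.Finite.exists_fin' A I
  let J := {K : Submodule A (Fin n → A) // K.FG ∧ K ≤ LinearMap.ker p}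
  have : Nonempty J := ⟨⟨⊥, Submodule.fg_bot, bot_le⟩⟩
  have : IsDirectedOrder J := ⟨fun a b =>
    ⟨⟨a.1 ⊔ b.1, a.2.1.sup b.2.1, sup_le a.2.2 b.2.2⟩,
      (le_sup_left : a.1 ≤ _), (le_sup_right : b.1 ≤ _)⟩⟩
  let D : J ⥤ ModuleCat.{u} A :=
    { obj := fun K => ModuleCat.of A ((Fin n → A) ⧸ K.1)
      map := fun {K K'} h => ModuleCat.ofHom (Submodule.factor (leOfHom h : K.1 ≤ K'.1))
      map_id := fun K => by
        refine ModuleCat.hom_ext (LinearMap.ext fun x => ?_)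
        obtain ⟨x, rfl⟩ := Submodule.mkQ_surjective _ x
        rfl
      map_comp := fun f g => by
        refine ModuleCat.hom_ext (LinearMap.ext fun x => ?_)
        obtain ⟨x, rfl⟩ := Submodule.mkQ_surjective _ x
        rfl }
  let c : Cocone D :=
    { pt := I
      ι := { app := fun K => ModuleCat.ofHom (K.1.liftQ p K.2.2)
             naturality := fun K K' h => by
              refine ModuleCat.hom_ext (LinearMap.ext fun x => ?_)
              obtain ⟨x, rfl⟩ := Submodule.mkQ_surjective _ x
              rfl } }
  obtain ⟨j, y, hy⟩ := aux_rep F D c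
    (fun x => by
      obtain ⟨z, rfl⟩ := hp x
      exact ⟨⟨⊥, Submodule.fg_bot, bot_le⟩, Submodule.mkQ _ z, rfl⟩)
    (fun i x y h => by
      obtain ⟨x, rfl⟩ := Submodule.mkQ_surjective _ x
      obtain ⟨y, rfl⟩ := Submodule.mkQ_surjective _ y
      have h' : p x = p y := h
      have hle : i.1 ≤ i.1 ⊔ Submodule.span A {x - y} := le_sup_left
      let k : J := ⟨i.1 ⊔ Submodule.span A {x - y},
        i.2.1.sup (Submodule.fg_span_singleton _), sup_le i.2.2 (by
          rw [Submodule.span_singleton_le_iff_mem, LinearMap.mem_ker, map_sub, h', sub_self])⟩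
      refine ⟨k, homOfLE hle, ?_⟩
      change (Submodule.mkQ k.1 x) = Submodule.mkQ k.1 y
      exact (Submodule.Quotient.eq _).mpr
        (Submodule.mem_sup_right (Submodule.mem_span_singleton_self _))) η
  refine ⟨D.obj j, c.ι.app j, y, ?_, hy⟩
  exact Module.finitePresentation_of_surjective (Submodule.mkQ j.1) (Submodule.mkQ_surjective _)
    (by rw [Submodule.ker_mkQ]; exact j.2.1)

theorem aux_finite (A B : Type u) [CommRing A] [CommRing B] [Algebra A B] [IsNoetherianRing B]
    (I M X : Type u) [AddCommGroup I] [Module A I] [Module.Finite A I]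
    [AddCommGroup M] [Module A M] [Module B M] [IsScalarTower A B M] [Module.Finite B M]
    [SMulCommClass A B M]
    [AddCommGroup X] [Module B X] (g : (I →ₗ[A] M) →ₗ[B] X) (hg : Function.Surjective g) :
    Module.Finite B X := by
  obtain ⟨n, p, hp⟩ := Module.Finite.exists_fin' A I
  let e : (I →ₗ[A] M) →ₗ[B] (Fin n → M) :=
    { toFun := fun f i => f (p (Pi.single i 1))
      map_add' := fun _ _ => rfl
      map_smul' := fun _ _ => rfl }
  have he : Function.Injective e := by
    intro f f' h
    have : f ∘ₗ p = f' ∘ₗ p := by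
      apply LinearMap.pi_ext'
      intro i
      ext
      exact congrFun h i
    ext x
    obtain ⟨z, rfl⟩ := hp x
    exact LinearMap.congr_fun this z
  have : Module.Finite B (I →ₗ[A] M) := Module.Finite.of_injective e he
  exact Module.Finite.of_surjective g hg

/-- If `F : Mod_A → Mod_A` is an `A`-linear functor preserving filtered colimits which is
finitely generated, then `F` has a generator `(I, η)` in which `I` is a finitely presented
`A`-module.  In particular, if `A` is noetherian, then `F(M)` is finitely generated for
every finitely generated module `M`, and the same holds after base change to any
noetherian `A`-algebra `B` (where `F(M)` carries a `B`-module structure compatible with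
its `A`-module structure). -/
theorem stmt16 (A : Type u) [CommRing A] (F : ModuleCat.{u} A ⥤ ModuleCat.{u} A)
    [F.Additive] [F.Linear A] [PreservesFilteredColimits F]
    (hfg : F.IsFinitelyGenerated) :
    (∃ (I : ModuleCat.{u} A) (η : F.obj I), Module.FinitePresentation A I ∧
      ∀ (M : ModuleCat.{u} A) (x : F.obj M), ∃ f : I ⟶ M, F.map f η = x) ∧
    (IsNoetherianRing A →
      ∀ M : ModuleCat.{u} A, Module.Finite A M → Module.Finite A (F.obj M)) ∧
    (IsNoetherianRing A →
      ∀ (B : Type u) [CommRing B] [Algebra A B], IsNoetherianRing B →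
        ∀ (M : Type u) [AddCommGroup M] [Module A M] [Module B M]
          [IsScalarTower A B M], Module.Finite B M →
          ∃ _inst : Module B (F.obj (ModuleCat.of A M)),
            IsScalarTower A B (F.obj (ModuleCat.of A M)) ∧
              Module.Finite B (F.obj (ModuleCat.of A M))) := by
  have h1 : ∃ (I : ModuleCat.{u} A) (η : F.obj I), Module.FinitePresentation A I ∧
      ∀ (M : ModuleCat.{u} A) (x : F.obj M), ∃ f : I ⟶ M, F.map f η = x := by
    obtain ⟨I, η, hη⟩ := hfg
    obtain ⟨N, g, y, hN, rfl⟩ := aux_step1 F I η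
    obtain ⟨P, g', z, hP, rfl⟩ := aux_step2 F N y
    refine ⟨P, z, hP, fun M x => ?_⟩
    obtain ⟨f, hf⟩ := hη M x
    exact ⟨g' ≫ g ≫ f, by simpa using hf⟩
  refine ⟨h1, ?_, ?_⟩
  · intro hA M hM
    obtain ⟨I, η, hI, hη⟩ := h1
    let g : (I →ₗ[A] M) →ₗ[A] F.obj M :=
      { toFun := fun f => F.map (ModuleCat.ofHom f) η
        map_add' := fun f f' => by
          rw [ModuleCat.ofHom_add, F.map_add]; rfl
        map_smul' := fun a f => by
          have : ModuleCat.ofHom (a • f) = a • ModuleCat.ofHom f := rfl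
          rw [this, F.map_smul]; rfl }
    exact aux_finite A A I M _ g (fun x => by
      obtain ⟨f, hf⟩ := hη M x
      exact ⟨f.hom, hf⟩)
  · intro hA B _ _ hB M _ _ _ _ hM
    obtain ⟨I, η, hI, hη⟩ := h1
    have : SMulCommClass A B M := IsScalarTower.to_smulCommClass
    let m : B → (ModuleCat.of A M ⟶ ModuleCat.of A M) := fun b =>
      ModuleCat.ofHom
        { toFun := fun x => b • x
          map_add' := smul_add b
          map_smul' := fun a x => (smul_comm a b x).symm }
    have m_one : m 1 = 𝟙 _ := by ext x; exact one_smul B (x : M)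
    have m_zero : m 0 = 0 := by ext x; exact zero_smul B (x : M)
    have m_add : ∀ b b', m (b + b') = m b + m b' := fun b b' => by
      ext x; exact add_smul b b' (x : M)
    have m_mul : ∀ b b', m (b * b') = m b' ≫ m b := fun b b' => by
      ext x; exact mul_smul b b' (x : M)
    have m_smul : ∀ (a : A) b, m (a • b) = a • m b := fun a b => by
      ext x; exact smul_assoc a b (x : M)
    let inst : Module B (F.obj (ModuleCat.of A M)) :=
      { smul := fun b x => F.map (m b) x
        one_smul := fun x => by
          change F.map (m 1) x = x
          rw [m_one, F.map_id]; rfl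
        mul_smul := fun b b' x => by
          change F.map (m (b * b')) x = F.map (m b) (F.map (m b') x)
          rw [m_mul, F.map_comp]; rfl
        smul_zero := fun b => map_zero (F.map (m b)).hom
        smul_add := fun b x y => map_add (F.map (m b)).hom x y
        add_smul := fun b b' x => by
          change F.map (m (b + b')) x = F.map (m b) x + F.map (m b') x
          rw [m_add, F.map_add]; rfl
        zero_smul := fun x => by
          change F.map (m 0) x = 0
          rw [m_zero, F.map_zero]; rfl }
    refine ⟨inst, ⟨fun a b x => ?_⟩, ?_⟩
    · change F.map (m (a • b)) x = a • F.map (m b) x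
      rw [m_smul, F.map_smul]; rfl
    · let g : (I →ₗ[A] M) →ₗ[B] F.obj (ModuleCat.of A M) :=
        { toFun := fun f => F.map (ModuleCat.ofHom f : I ⟶ ModuleCat.of A M) η
          map_add' := fun f f' => by
            rw [ModuleCat.ofHom_add, F.map_add]; rfl
          map_smul' := fun b f => by
            have : (ModuleCat.ofHom (b • f) : I ⟶ ModuleCat.of A M) =
              ModuleCat.ofHom f ≫ m b := rfl
            rw [this, F.map_comp]; rfl }
      exact aux_finite A B I M _ g (fun x => by
        obtain ⟨f, hf⟩ := hη _ x
        exact ⟨f.hom, hf⟩)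
end
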